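/- For every chores instance with n agents and identical valuations (all agents share the same additive valuation), there exists an allocation that is both DEF-(n-1) and Pareto optimal. -/

import Mathlib

open Finset

variable {N M : Type*}

/-- An allocation partitions the chores `M` into bundles, one per agent. -/
def IsAllocation [DecidableEq M] (A : N → Finset M) : Prop :=
  (∀ i j : N, i ≠ j → Disjoint (A i) (A j)) ∧ ∀ c : M, ∃ i : N, c ∈ A i

/-- Additive value of a bundle. -/
def val (v : M → ℤ) (S : Finset M) : ℤ := ∑ c ∈ S, v c

/-- Envy-freeness up to `k` dubious chores. -/
def DEF [Fintype N] (v : N → M → ℤ) (A : N → Finset M) (k : ℕ) : Prop :=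
  ∃ D : N → Multiset M,
    (∑ i : N, Multiset.card (D i)) ≤ k ∧
    ∀ i h : N, i ≠ h →
      val (v i) (A i) ≥ val (v i) (A h) + (Multiset.map (v i) (D h)).sum

/-- Envy-freeness up to one chore. -/
def EF1 [DecidableEq M] (v : N → M → ℤ) (A : N → Finset M) : Prop :=
  ∀ i h : N, i ≠ h → A i ≠ ∅ →
    ∃ c ∈ A i, val (v i) ((A i).erase c) ≥ val (v i) (A h)

/-- Pareto optimality. -/
def ParetoOptimal [DecidableEq M] (v : N → M → ℤ) (A : N → Finset M) : Prop :=
  ¬ ∃ B : N → Finset M, IsAllocation B ∧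
      (∀ i, val (v i) (B i) ≥ val (v i) (A i)) ∧
      ∃ j, val (v j) (B j) > val (v j) (A j)

/-- Total price of a bundle. -/
def price (p : M → ℝ) (S : Finset M) : ℝ := ∑ c ∈ S, p c

/-- Fisher market equilibrium: prices are positive and every agent receives only
its minimum pain per buck chores. -/
def FisherEq (v : N → M → ℤ) (p : M → ℝ) (A : N → Finset M) : Prop :=
  (∀ c, 0 < p c) ∧
  ∀ i : N, ∀ c ∈ A i, ∀ c' : M, |(v i c : ℝ)| / p c ≤ |(v i c' : ℝ)| / p c'

/-- Price envy-freeness up to one item. -/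
def pEF1 [DecidableEq M] (p : M → ℝ) (A : N → Finset M) : Prop :=
  ∀ i j : N, A i = ∅ ∨ ∃ c ∈ A i, price p ((A i).erase c) ≤ price p (A j)

/-- The bundle values of an allocation add up to the value of all the chores. -/
theorem IsAllocation.sum_val {N M : Type*} [Fintype N] [Fintype M] [DecidableEq M]
    {A : N → Finset M} (hA : IsAllocation A) (v : M → ℤ) :
    ∑ i, val v (A i) = ∑ c, v c := by
  have huniv : (univ : Finset N).biUnion A = univ := by
    ext c
    simpa using hA.2 c
  rw [← huniv, Finset.sum_biUnion fun i _ j _ hij => hA.1 i j hij]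
  rfl

/-- With identical valuations every allocation is Pareto optimal. -/
theorem IsAllocation.paretoOptimal {N M : Type*} [Fintype N] [Fintype M] [DecidableEq M]
    {A : N → Finset M} (hA : IsAllocation A) (v : M → ℤ) :
    ParetoOptimal (fun _ : N => v) A := by
  rintro ⟨B, hB, hge, j, hj⟩
  have hlt : ∑ i, val v (A i) < ∑ i, val v (B i) :=
    Finset.sum_lt_sum (fun i _ => hge i) ⟨j, mem_univ j, hj⟩
  rw [hA.sum_val, hB.sum_val] at hlt
  exact lt_irrefl _ hlt

/-- Greedy balancing: the chores of `S` can be distributed so that bundle values differ by at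
most the size of a lower bound `m` on the values of single chores. -/
theorem exists_balanced_assignment {N M : Type*} [Finite N] [Nonempty N] [DecidableEq N]
    [DecidableEq M] {v : M → ℤ} (hv : ∀ c, v c ≤ 0) {m : ℤ} (hm : m ≤ 0) (hmv : ∀ c, m ≤ v c)
    (S : Finset M) :
    ∃ f : M → N, ∀ i h, val v (S.filter (f · = h)) + m ≤ val v (S.filter (f · = i)) := by
  induction S using Finset.induction_on with
  | empty => exact ⟨fun _ => Classical.arbitrary N, by simpa [_root_.val] using hm⟩
  | insert c S hc ih =>
    obtain ⟨f, hf⟩ := ih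
    obtain ⟨j, hj⟩ := Finite.exists_max fun i => val v (S.filter (f · = i))
    have hval : ∀ i, val v ((insert c S).filter (Function.update f c j · = i)) =
        val v (S.filter (f · = i)) + if i = j then v c else 0 := by
      intro i
      simp only [_root_.val, Finset.sum_filter]
      rw [Finset.sum_insert hc, Function.update_self, add_comm]
      congr 1
      · refine Finset.sum_congr rfl fun d hd => ?_
        rw [Function.update_of_ne (ne_of_mem_of_not_mem hd hc)]
      · simp only [eq_comm]
    refine ⟨Function.update f c j, fun i h => ?_⟩
    rw [hval, hval]
    have hih := hf i h
    have hjh := hj h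
    have hvc := hv c
    have hmc := hmv c
    split_ifs with h₁ h₂ h₂
    · linarith
    · linarith
    · subst h₂
      linarith
    · linarith

/-- for every chores instance with identical valuations there exists a
DEF-(n-1) and Pareto optimal allocation. -/
theorem identical_valuations_exists_def_po {n : ℕ} (hn : 0 < n)
    {M : Type*} [Fintype M] [DecidableEq M]
    (v0 : M → ℤ) (hv : ∀ c, v0 c ≤ 0) :
    ∃ A : Fin n → Finset M, IsAllocation A ∧
      DEF (fun _ : Fin n => v0) A (n - 1) ∧ ParetoOptimal (fun _ : Fin n => v0) A := by
  have : Nonempty (Fin n) := ⟨⟨0, hn⟩⟩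
  have hpart : ∀ f : M → Fin n, IsAllocation fun i => univ.filter (f · = i) := by
    refine fun f => ⟨fun i j hij => ?_, fun c => ⟨f c, by simp⟩⟩
    rw [Finset.disjoint_left]
    intro c hi hj
    simp only [mem_filter, mem_univ, true_and] at hi hj
    exact hij (hi.symm.trans hj)
  rcases isEmpty_or_nonempty M with hM | hM
  · refine ⟨_, hpart isEmptyElim, ⟨fun _ => 0, by simp, fun i h _ => ?_⟩,
      (hpart _).paretoOptimal v0⟩
    simp [_root_.val]
  · obtain ⟨c, hc⟩ := Finite.exists_min v0
    obtain ⟨f, hf⟩ := exists_balanced_assignment (N := Fin n) hv (hv c) hc univ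
    obtain ⟨j, hj⟩ := Finite.exists_min fun i => val v0 (univ.filter (f · = i))
    refine ⟨_, hpart f, ⟨fun i => if i = j then 0 else {c}, ?_, fun i h _ => ?_⟩,
      (hpart f).paretoOptimal v0⟩
    · simp [apply_ite Multiset.card, Finset.sum_ite, Finset.filter_ne']
    · by_cases hh : h = j
      · subst hh
        simpa using hj i
      · simpa [hh] using hf i h
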